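/- Let k ≥ 2 be an integer and ε > 0 a constant. There exists a positive constant δ = δ(ε) such that if p₀ = p₀(n) ≥ (1+ε)·log n/(kn) and p' = p'(n) ≤ ε·p₀, then asymptotically almost surely the following holds for G⁻ ∼ G_{n,p₀}, G⁺ = G⁻ ∪ G_{n,p'}, and p₁ = 1 − (1−p₀)(1−p'): every vertex v of G⁺ satisfies |N³_{G⁺}(v) ∩ (TINY_{p₀,δ}(G⁻) ∪ TINY_{p₁,δ}(G⁺))| ≤ k − 1. -/

import Mathlib

open MeasureTheory Filter ENNReal

namespace RGP

noncomputable section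

variable {V : Type*}

/-- The degree of a vertex. -/
def deg (G : SimpleGraph V) (v : V) : ℕ := (G.neighborSet v).ncard

/-- `N^ℓ_G(v)`: vertices at distance at most `ℓ` from `v`, excluding `v`. -/
def nbhd (G : SimpleGraph V) (ℓ : ℕ) (v : V) : Set V :=
  {u | u ≠ v ∧ ∃ p : G.Walk v u, p.length ≤ ℓ}

/-- `TINY_{p,δ}(G)`. -/
def TINY (G : SimpleGraph V) (p δ : ℝ) : Set V :=
  {v | (deg G v : ℝ) < δ * (Nat.card V) * p}

/-- `ATYP_{p,δ}(G)`. -/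
def ATYP (G : SimpleGraph V) (p δ : ℝ) : Set V :=
  {v | (deg G v : ℝ) < (1 - δ) * (Nat.card V) * p ∨ (1 + δ) * (Nat.card V) * p < (deg G v : ℝ)}

/-- Edge density `|E| / C(n,2)`. -/
def density (G : SimpleGraph V) : ℝ :=
  (G.edgeSet.ncard : ℝ) / ((Nat.card V).choose 2 : ℕ)

/-- A matching covering all but at most one vertex. -/
def HasNearPerfectMatching (G : SimpleGraph V) : Prop :=
  ∃ M : G.Subgraph, M.IsMatching ∧ (M.vertsᶜ).ncard ≤ 1

/-- Hamiltonicity (for finite vertex types). -/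
def IsHam [Finite V] (G : SimpleGraph V) : Prop :=
  letI := Classical.decEq V; letI := Fintype.ofFinite V; G.IsHamiltonian

/-- `α`-resilience with respect to a property `P`. -/
def Resilient (G : SimpleGraph V) (α : ℝ) (P : SimpleGraph V → Prop) : Prop :=
  ∀ H : SimpleGraph V, H ≤ G → (∀ v, (deg H v : ℝ) ≤ α * (deg G v : ℝ)) → P (G \ H)

/-- `(α, δt, Kt, δa, Ka)`-resilience with respect to a property `P`. -/
def StrongResilient (G : SimpleGraph V) (α δt : ℝ) (Kt : ℕ) (δa : ℝ) (Ka : ℕ)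
    (P : SimpleGraph V → Prop) : Prop :=
  ∀ H : SimpleGraph V, H ≤ G →
    (∀ v ∈ TINY G (density G) δt, (deg H v : ℝ) ≤ (deg G v : ℝ) - Kt) →
    (∀ v, v ∈ ATYP G (density G) δa → v ∉ TINY G (density G) δt →
      (deg H v : ℝ) ≤ (deg G v : ℝ) - Ka) →
    (∀ v, v ∉ TINY G (density G) δt → v ∉ ATYP G (density G) δa →
      (deg H v : ℝ) ≤ α * (deg G v : ℝ)) →
    P (G \ H)

/-! ### The random graph process -/

/-- Potential edges of the complete graph on `Fin n`. -/
abbrev EdgeType (n : ℕ) := {e : Sym2 (Fin n) // ¬ e.IsDiag}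

/-- A sample point of the random graph process: a uniformly random ordering of the edges. -/
abbrev ProcessSpace (n : ℕ) := Fin (Fintype.card (EdgeType n)) ≃ EdgeType n

instance (n : ℕ) : MeasurableSpace (ProcessSpace n) := ⊤

/-- The uniform measure on orderings of the edges of `K_n`. -/
def processMeasure (n : ℕ) : Measure (ProcessSpace n) :=
  (Fintype.card (ProcessSpace n) : ℝ≥0∞)⁻¹ • Measure.sum (fun σ => Measure.dirac σ)

/-- The graph `G_m` of the process: the first `m` edges in the random ordering. -/
def processGraph {n : ℕ} (σ : ProcessSpace n) (m : ℕ) : SimpleGraph (Fin n) :=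
  SimpleGraph.fromEdgeSet {e | ∃ i : Fin (Fintype.card (EdgeType n)), (i : ℕ) < m ∧ (σ i : Sym2 (Fin n)) = e}

/-! ### The binomial random graph G(n,p) -/

abbrev GnpSpace (n : ℕ) := EdgeType n → Bool

/-- The Bernoulli product weight of an outcome. -/
def gnpWeight {n : ℕ} (p : ℝ) (ω : GnpSpace n) : ℝ≥0∞ :=
  ∏ e : EdgeType n, (if ω e then ENNReal.ofReal p else ENNReal.ofReal (1 - p))

/-- The `G(n,p)` probability measure. -/
def gnp (n : ℕ) (p : ℝ) : Measure (GnpSpace n) :=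
  Measure.sum (fun ω => gnpWeight p ω • Measure.dirac ω)

/-- The graph determined by an outcome of `G(n,p)`. -/
def gnpGraph {n : ℕ} (ω : GnpSpace n) : SimpleGraph (Fin n) :=
  SimpleGraph.fromEdgeSet {e | ∃ h : ¬ e.IsDiag, ω ⟨e, h⟩ = true}

/-- Joint distribution of two independent binomial random graphs. -/
def gnp2 (n : ℕ) (p₀ p' : ℝ) : Measure (GnpSpace n × GnpSpace n) :=
  Measure.sum (fun ω : GnpSpace n × GnpSpace n =>
    (gnpWeight p₀ ω.1 * gnpWeight p' ω.2) • Measure.dirac ω)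

/-! ### The 2-core -/

/-- The vertex set of the 2-core: the largest set every vertex of which has
at least two neighbours inside the set. -/
def coreSet (G : SimpleGraph V) : Set V :=
  ⋃₀ {S : Set V | ∀ v ∈ S, 2 ≤ ((G.neighborSet v) ∩ S).ncard}

/-- The 2-core of a graph, as a graph on the corresponding vertex subset. -/
def twoCore (G : SimpleGraph V) : SimpleGraph (coreSet G) := G.induce (coreSet G)


/-! ### Growing trees -/

/-- Pairs `(T, E)` where `T` is the vertex set and `E` the edge set of a tree with `m` edges,
built by successively attaching leaves. -/
def grownTrees (n : ℕ) : ℕ → Finset (Finset (Fin n) × Finset (Sym2 (Fin n)))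
  | 0 => Finset.univ.image fun v => ({v}, ∅)
  | m + 1 => (grownTrees n m).biUnion fun S =>
      (S.1 ×ˢ S.1ᶜ).image fun xy => (insert xy.2 S.1, insert s(xy.1, xy.2) S.2)

lemma card_grownTrees_le (n m : ℕ)
    (h : ∀ S ∈ grownTrees n m, S.1.card = m + 1) :
    (grownTrees n (m + 1)).card ≤ (grownTrees n m).card * ((m + 1) * n) := by
  refine Finset.card_biUnion_le_card_mul _ _ _ fun S hS => ?_
  refine Finset.card_image_le.trans ?_
  rw [Finset.card_product, h S hS]
  exact Nat.mul_le_mul_left _ ((Finset.card_le_univ _).trans (by simp))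

lemma grownTrees_spec {n m : ℕ} {S : Finset (Fin n) × Finset (Sym2 (Fin n))}
    (hS : S ∈ grownTrees n m) :
    S.1.card = m + 1 ∧ S.2.card = m ∧ (∀ e ∈ S.2, ¬ e.IsDiag) ∧
      ∀ e ∈ S.2, ∀ x ∈ e, x ∈ S.1 := by
  induction m generalizing S with
  | zero =>
    simp only [grownTrees, Finset.mem_image, Finset.mem_univ, true_and] at hS
    obtain ⟨v, rfl⟩ := hS
    simp
  | succ m ih =>
    simp only [grownTrees, Finset.mem_biUnion, Finset.mem_image, Finset.mem_product,
      Finset.mem_compl, Prod.exists] at hS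
    obtain ⟨T, E, hTE, x, y, ⟨hx, hy⟩, rfl⟩ := hS
    obtain ⟨h1, h2, h3, h4⟩ := ih hTE
    have hxy : x ≠ y := fun h => hy (h ▸ hx)
    have hE : s(x, y) ∉ E := fun h => hy (h4 _ h y (Sym2.mem_mk_right x y))
    refine ⟨?_, ?_, ?_, ?_⟩
    · simpa [Finset.card_insert_of_notMem hy] using h1
    · simpa [Finset.card_insert_of_notMem hE] using h2
    · intro e he
      rcases Finset.mem_insert.1 he with rfl | he
      · simpa using hxy
      · exact h3 e he
    · intro e he z hz
      rcases Finset.mem_insert.1 he with rfl | he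
      · rcases Sym2.mem_iff.1 hz with rfl | rfl
        · exact Finset.mem_insert_of_mem hx
        · exact Finset.mem_insert_self _ _
      · exact Finset.mem_insert_of_mem (h4 e he z hz)

lemma card_grownTrees (n m : ℕ) : (grownTrees n m).card ≤ n ^ (m + 1) * m.factorial := by
  induction m with
  | zero =>
    simp only [grownTrees]
    exact Finset.card_image_le.trans (by simp)
  | succ m ih =>
    refine (card_grownTrees_le n m fun S hS => (grownTrees_spec hS).1).trans ?_
    refine (Nat.mul_le_mul_right _ ih).trans (le_of_eq ?_)
    rw [Nat.factorial_succ]; ring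

lemma exists_grownTree_of_walk {n : ℕ} (G : SimpleGraph (Fin n)) {x u : Fin n} (p : G.Walk x u) :
    ∀ {m : ℕ} {S : Finset (Fin n) × Finset (Sym2 (Fin n))}, S ∈ grownTrees n m → x ∈ S.1 →
      (∀ e ∈ S.2, e ∈ G.edgeSet) →
      ∃ m' ≤ m + p.length, ∃ S' ∈ grownTrees n m', S.1 ⊆ S'.1 ∧ u ∈ S'.1 ∧
        ∀ e ∈ S'.2, e ∈ G.edgeSet := by
  induction p with
  | nil => exact fun {m S} hS hx hE => ⟨m, by simp, S, hS, subset_rfl, hx, hE⟩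
  | @cons x y u hxy p ih =>
    intro m S hS hx hE
    by_cases hy : y ∈ S.1
    · obtain ⟨m', hm', h⟩ := ih hS hy hE
      exact ⟨m', by simp only [SimpleGraph.Walk.length_cons]; omega, h⟩
    · have hmem : (insert y S.1, insert s(x, y) S.2) ∈ grownTrees n (m + 1) := by
        simp only [grownTrees, Finset.mem_biUnion, Finset.mem_image, Finset.mem_product,
          Finset.mem_compl, Prod.exists]
        exact ⟨S.1, S.2, hS, x, y, ⟨hx, hy⟩, rfl⟩
      obtain ⟨m', hm', S', hS', hsub, hu, hE'⟩ := ih hmem (Finset.mem_insert_self _ _) (by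
        intro e he
        rcases Finset.mem_insert.1 he with rfl | he
        · exact hxy
        · exact hE e he)
      exact ⟨m', by simp only [SimpleGraph.Walk.length_cons]; omega, S', hS',
        (Finset.subset_insert _ _).trans hsub, hu, hE'⟩

lemma exists_grownTree {n : ℕ} (G : SimpleGraph (Fin n)) (v : Fin n) (ℓ : ℕ)
    (U : Finset (Fin n)) (hU : ∀ u ∈ U, ∃ p : G.Walk v u, p.length ≤ ℓ) :
    ∃ m ≤ ℓ * U.card, ∃ S ∈ grownTrees n m, v ∈ S.1 ∧ U ⊆ S.1 ∧ ∀ e ∈ S.2, e ∈ G.edgeSet := by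
  induction U using Finset.induction_on with
  | empty => exact ⟨0, by simp, ({v}, ∅), by simp [grownTrees], by simp⟩
  | insert u U hu ih =>
    obtain ⟨m, hm, S, hS, hv, hUS, hE⟩ := ih fun w hw => hU w (Finset.mem_insert_of_mem hw)
    obtain ⟨p, hp⟩ := hU u (Finset.mem_insert_self _ _)
    obtain ⟨m', hm', S', hS', hsub, hu', hE'⟩ := exists_grownTree_of_walk G p hS hv hE
    refine ⟨m', ?_, S', hS', hsub hv, ?_, hE'⟩
    · rw [Finset.card_insert_of_notMem hu, mul_add, mul_one]; omega
    · exact Finset.insert_subset hu' (hUS.trans hsub)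

/-! ### Product structure of the joint distribution -/

/-- The Bernoulli weight of a single edge. -/
def bernWeight (p : ℝ) (b : Bool) : ℝ := if b then p else 1 - p

lemma bernWeight_nonneg {p : ℝ} (h0 : 0 ≤ p) (h1 : p ≤ 1) (b : Bool) : 0 ≤ bernWeight p b := by
  cases b <;> simp [bernWeight, h0, h1]

lemma gnpWeight_eq_ofReal {n : ℕ} {p : ℝ} (h0 : 0 ≤ p) (h1 : p ≤ 1) (ω : GnpSpace n) :
    gnpWeight p ω = ENNReal.ofReal (∏ e, bernWeight p (ω e)) := by
  rw [ENNReal.ofReal_prod_of_nonneg fun e _ => bernWeight_nonneg h0 h1 _]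
  refine Finset.prod_congr rfl fun e _ => ?_
  cases ω e <;> simp [bernWeight]

lemma gnp2_apply (n : ℕ) (p₀ p' : ℝ) (A : Set (GnpSpace n × GnpSpace n)) :
    gnp2 n p₀ p' A = ∑ ω, gnpWeight p₀ ω.1 * gnpWeight p' ω.2 * A.indicator 1 ω := by
  rw [gnp2, Measure.sum_apply _ (Set.toFinite A).measurableSet, tsum_fintype]
  refine Finset.sum_congr rfl fun ω _ => ?_
  rw [Measure.smul_apply, Measure.dirac_apply, smul_eq_mul]

/-- The expectation of a product of functions of single edges factorizes. -/
lemma sum_prod_edges {n : ℕ} (p₀ p' : ℝ) (g : EdgeType n → Bool → Bool → ℝ) :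
    ∑ ω : GnpSpace n × GnpSpace n, (∏ e, bernWeight p₀ (ω.1 e)) * (∏ e, bernWeight p' (ω.2 e)) *
        ∏ e, g e (ω.1 e) (ω.2 e) =
      ∏ e, ∑ b : Bool × Bool, bernWeight p₀ b.1 * bernWeight p' b.2 * g e b.1 b.2 := by
  rw [Fintype.prod_sum]
  refine (Fintype.sum_equiv (Equiv.arrowProdEquivProdArrow (EdgeType n) (fun _ => Bool)
    (fun _ => Bool)) _ _ fun ω => ?_).symm
  simp [Equiv.arrowProdEquivProdArrow, Finset.prod_mul_distrib]

lemma isProbabilityMeasure_gnp2 (n : ℕ) {p₀ p' : ℝ} (h0 : 0 ≤ p₀) (h1 : p₀ ≤ 1) (h0' : 0 ≤ p')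
    (h1' : p' ≤ 1) : IsProbabilityMeasure (gnp2 n p₀ p') := by
  constructor
  rw [gnp2_apply]
  have h := sum_prod_edges (n := n) p₀ p' fun _ _ _ => 1
  simp only [Finset.prod_const_one, mul_one, Fintype.sum_prod_type] at h
  have h' : ∑ a : Bool, ∑ b : Bool, bernWeight p₀ a * bernWeight p' b = 1 := by
    simp [bernWeight]; ring
  rw [h', Finset.prod_const_one, ← Fintype.sum_prod_type'] at h
  rw [← ENNReal.ofReal_one, ← h, ENNReal.ofReal_sum_of_nonneg]
  · refine Finset.sum_congr rfl fun ω _ => ?_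
    rw [gnpWeight_eq_ofReal h0 h1, gnpWeight_eq_ofReal h0' h1', ENNReal.ofReal_mul]
    · simp
    · exact Finset.prod_nonneg fun e _ => bernWeight_nonneg h0 h1 _
  · exact fun ω _ => mul_nonneg (Finset.prod_nonneg fun e _ => bernWeight_nonneg h0 h1 _)
      (Finset.prod_nonneg fun e _ => bernWeight_nonneg h0' h1' _)

/-- Markov's inequality for a nonnegative multiple of a product over the edges. -/
lemma gnp2_le_of_prod {n : ℕ} {p₀ p' : ℝ} (h0 : 0 ≤ p₀) (h1 : p₀ ≤ 1) (h0' : 0 ≤ p')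
    (h1' : p' ≤ 1) (A : Set (GnpSpace n × GnpSpace n)) (c : ℝ) (hc : 0 ≤ c)
    (g : EdgeType n → Bool → Bool → ℝ) (hg : ∀ e a b, 0 ≤ g e a b)
    (hA : ∀ ω ∈ A, 1 ≤ c * ∏ e, g e (ω.1 e) (ω.2 e)) :
    gnp2 n p₀ p' A ≤ ENNReal.ofReal
      (c * ∏ e, ∑ b : Bool × Bool, bernWeight p₀ b.1 * bernWeight p' b.2 * g e b.1 b.2) := by
  have hw : ∀ ω : GnpSpace n × GnpSpace n,
      0 ≤ (∏ e, bernWeight p₀ (ω.1 e)) * (∏ e, bernWeight p' (ω.2 e)) := fun ω =>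
    mul_nonneg (Finset.prod_nonneg fun e _ => bernWeight_nonneg h0 h1 _)
      (Finset.prod_nonneg fun e _ => bernWeight_nonneg h0' h1' _)
  have hG : ∀ ω : GnpSpace n × GnpSpace n, 0 ≤ c * ∏ e, g e (ω.1 e) (ω.2 e) := fun ω =>
    mul_nonneg hc (Finset.prod_nonneg fun e _ => hg _ _ _)
  rw [← sum_prod_edges, Finset.mul_sum, gnp2_apply, ENNReal.ofReal_sum_of_nonneg]
  · refine Finset.sum_le_sum fun ω _ => ?_
    rw [gnpWeight_eq_ofReal h0 h1, gnpWeight_eq_ofReal h0' h1',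
      ← ENNReal.ofReal_mul (Finset.prod_nonneg fun e _ => bernWeight_nonneg h0 h1 _),
      mul_left_comm, ENNReal.ofReal_mul (hw ω)]
    gcongr
    by_cases hω : ω ∈ A
    · simpa [hω] using hA ω hω
    · simp [hω]
  · intro ω _
    rw [mul_left_comm]
    exact mul_nonneg (hw ω) (hG ω)

lemma prod_edges_ite_mul_ite {n : ℕ} (E F : Finset (Sym2 (Fin n))) (hE : ∀ e ∈ E, ¬ e.IsDiag)
    (hF : ∀ e ∈ F, ¬ e.IsDiag) (a b : ℝ) :
    ∏ e : EdgeType n, ((if (e : Sym2 (Fin n)) ∈ E then a else 1) *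
      (if (e : Sym2 (Fin n)) ∈ F then b else 1)) = a ^ E.card * b ^ F.card := by
  have key : ∀ (E : Finset (Sym2 (Fin n))) (_ : ∀ e ∈ E, ¬ e.IsDiag) (a : ℝ),
      ∏ e : EdgeType n, (if (e : Sym2 (Fin n)) ∈ E then a else 1) = a ^ E.card := by
    intro E hE a
    rw [← Finset.prod_filter, Finset.prod_const]
    congr 1
    refine Finset.card_bij (fun e _ => (e : Sym2 (Fin n))) (by simp) (by simp [Subtype.ext_iff])
      fun e he => ⟨⟨e, hE e he⟩, by simpa using he, rfl⟩
  rw [Finset.prod_mul_distrib, key E hE, key F hF]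

lemma mem_edgeSet_gnpGraph {n : ℕ} (ω : GnpSpace n) (e : EdgeType n) :
    (e : Sym2 (Fin n)) ∈ (gnpGraph ω).edgeSet ↔ ω e = true := by
  obtain ⟨e, he⟩ := e
  simp [gnpGraph, SimpleGraph.edgeSet_fromEdgeSet, he]

/-- Probability that `E` is contained in the union of both graphs, while few edges of `F` are
present in the first graph. -/
lemma gnp2_edges_le {n : ℕ} {p₀ p' : ℝ} (h0 : 0 ≤ p₀) (h1 : p₀ ≤ 1) (h0' : 0 ≤ p')
    (h1' : p' ≤ 1) (E F : Finset (Sym2 (Fin n))) (hE : ∀ e ∈ E, ¬ e.IsDiag)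
    (hF : ∀ e ∈ F, ¬ e.IsDiag) (hEF : Disjoint E F) (t D : ℝ) (ht : 0 ≤ t) :
    gnp2 n p₀ p' {ω | (∀ e ∈ E, e ∈ (gnpGraph ω.1 ⊔ gnpGraph ω.2).edgeSet) ∧
        ((Finset.univ.filter fun e : EdgeType n => (e : Sym2 (Fin n)) ∈ F ∧ ω.1 e = true).card : ℝ)
          ≤ D} ≤
      ENNReal.ofReal (Real.exp (t * D) * ((1 - (1 - p₀) * (1 - p')) ^ E.card *
        (1 - p₀ * (1 - Real.exp (-t))) ^ F.card)) := by
  have hmark := gnp2_le_of_prod h0 h1 h0' h1'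
    {ω : GnpSpace n × GnpSpace n | (∀ e ∈ E, e ∈ (gnpGraph ω.1 ⊔ gnpGraph ω.2).edgeSet) ∧
        ((Finset.univ.filter fun e : EdgeType n => (e : Sym2 (Fin n)) ∈ F ∧ ω.1 e = true).card : ℝ)
          ≤ D} (Real.exp (t * D)) (Real.exp_pos _).le
    (fun e a b => (if (e : Sym2 (Fin n)) ∈ E then (if a || b then 1 else 0) else 1) *
      (if (e : Sym2 (Fin n)) ∈ F ∧ a = true then Real.exp (-t) else 1))
    (fun e a b => by positivity) ?_
  · refine hmark.trans (le_of_eq ?_)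
    rw [← prod_edges_ite_mul_ite E F hE hF]
    congr 2
    refine Finset.prod_congr rfl fun e _ => ?_
    by_cases heE : (e : Sym2 (Fin n)) ∈ E
    · have heF : (e : Sym2 (Fin n)) ∉ F := Finset.disjoint_left.1 hEF heE
      simp [heE, heF, Fintype.sum_prod_type, bernWeight]; ring
    · by_cases heF : (e : Sym2 (Fin n)) ∈ F
      · simp [heE, heF, Fintype.sum_prod_type, bernWeight]; ring
      · simp [heE, heF, Fintype.sum_prod_type, bernWeight]; ring
  · rintro ω ⟨hωE, hωF⟩
    have hprod : ∏ e : EdgeType n, ((if (e : Sym2 (Fin n)) ∈ E then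
        (if ω.1 e || ω.2 e then (1 : ℝ) else 0) else 1) *
        (if (e : Sym2 (Fin n)) ∈ F ∧ ω.1 e = true then Real.exp (-t) else 1)) =
        Real.exp (-t) ^ (Finset.univ.filter fun e : EdgeType n =>
          (e : Sym2 (Fin n)) ∈ F ∧ ω.1 e = true).card := by
      rw [Finset.prod_mul_distrib, Finset.prod_eq_one, one_mul, ← Finset.prod_filter,
        Finset.prod_const]
      intro e _
      split_ifs with h₁ h₂
      · rfl
      · exfalso
        have := hωE e h₁
        rw [SimpleGraph.edgeSet_sup, Set.mem_union, mem_edgeSet_gnpGraph,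
          mem_edgeSet_gnpGraph] at this
        simp_all
      · rfl
    rw [hprod, ← Real.exp_nat_mul, ← Real.exp_add]
    apply Real.one_le_exp
    nlinarith

lemma deg_mono {V : Type*} [Finite V] {G H : SimpleGraph V} (h : G ≤ H) (v : V) :
    deg G v ≤ deg H v :=
  Set.ncard_le_ncard (fun _ hw => h hw) (Set.toFinite _)

/-- The edges between `U` and the complement of `T`. -/
def crossEdges {n : ℕ} (U T : Finset (Fin n)) : Finset (Sym2 (Fin n)) :=
  (U ×ˢ Tᶜ).image fun xy => s(xy.1, xy.2)

lemma card_crossEdges {n : ℕ} {U T : Finset (Fin n)} (h : U ⊆ T) :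
    (crossEdges U T).card = U.card * (n - T.card) := by
  rw [crossEdges, Finset.card_image_of_injOn, Finset.card_product, Finset.card_compl,
    Fintype.card_fin]
  rintro ⟨a, b⟩ hab ⟨c, d⟩ hcd heq
  simp only [Finset.coe_product, Set.mem_prod, Finset.mem_coe, Finset.mem_compl] at hab hcd
  rcases Sym2.eq_iff.1 heq with ⟨rfl, rfl⟩ | ⟨rfl, rfl⟩
  · rfl
  · exact absurd (h hab.1) hcd.2

lemma card_crossEdges_inter_le {n : ℕ} (U T : Finset (Fin n)) (ω : GnpSpace n) :
    (Finset.univ.filter fun e : EdgeType n =>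
      (e : Sym2 (Fin n)) ∈ crossEdges U T ∧ ω e = true).card ≤ ∑ u ∈ U, deg (gnpGraph ω) u := by
  classical
  have hdeg : ∀ u, deg (gnpGraph ω) u =
      (Finset.univ.filter fun w => (gnpGraph ω).Adj u w).card := fun u => by
    rw [deg, ← Set.ncard_coe_finset]; congr 1; ext; simp
  simp only [hdeg]
  rw [← Finset.card_sigma, ← Finset.card_map ⟨Subtype.val, Subtype.val_injective⟩]
  refine (Finset.card_le_card ?_).trans
    (Finset.card_image_le (f := fun x : Sigma fun _ : Fin n => Fin n => s(x.1, x.2)))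
  intro e he
  simp only [Finset.mem_map, Finset.mem_filter, Finset.mem_univ, true_and,
    Function.Embedding.coeFn_mk] at he
  obtain ⟨e, ⟨heF, heω⟩, rfl⟩ := he
  have hadj := (mem_edgeSet_gnpGraph ω e).2 heω
  obtain ⟨⟨u, w⟩, huw, hs⟩ := Finset.mem_image.1 heF
  simp only at hs
  rw [← hs, SimpleGraph.mem_edgeSet] at hadj
  refine Finset.mem_image.2 ⟨⟨u, w⟩, ?_, hs⟩
  simpa using ⟨(Finset.mem_product.1 huw).1, hadj⟩

lemma gnp2_tree_le {n m : ℕ} {p₀ p' : ℝ} (h0 : 0 ≤ p₀) (h1 : p₀ ≤ 1) (h0' : 0 ≤ p')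
    (h1' : p' ≤ 1) {S : Finset (Fin n) × Finset (Sym2 (Fin n))} (hS : S ∈ grownTrees n m)
    {U : Finset (Fin n)} (hU : U ⊆ S.1) (t d : ℝ) (ht : 0 ≤ t) :
    gnp2 n p₀ p' {ω | (∀ e ∈ S.2, e ∈ (gnpGraph ω.1 ⊔ gnpGraph ω.2).edgeSet) ∧
        ∀ u ∈ U, (deg (gnpGraph ω.1) u : ℝ) ≤ d} ≤
      ENNReal.ofReal (Real.exp (t * (U.card * d)) * ((1 - (1 - p₀) * (1 - p')) ^ m *
        (1 - p₀ * (1 - Real.exp (-t))) ^ (U.card * (n - (m + 1))))) := by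
  obtain ⟨hT, hE, hdiag, hin⟩ := grownTrees_spec hS
  have hF : ∀ e ∈ crossEdges U S.1, ¬ e.IsDiag := by
    intro e he
    obtain ⟨⟨u, w⟩, huw, rfl⟩ := Finset.mem_image.1 he
    simp only [Finset.mem_product, Finset.mem_compl] at huw
    simp only [Sym2.mk_isDiag_iff]
    exact fun h => huw.2 (h ▸ hU huw.1)
  have hdisj : Disjoint S.2 (crossEdges U S.1) := by
    refine Finset.disjoint_left.2 fun e he he' => ?_
    obtain ⟨⟨u, w⟩, huw, rfl⟩ := Finset.mem_image.1 he'
    simp only [Finset.mem_product, Finset.mem_compl] at huw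
    exact huw.2 (hin _ he w (Sym2.mem_mk_right u w))
  have hmain := gnp2_edges_le h0 h1 h0' h1' S.2 (crossEdges U S.1) hdiag hF hdisj t
    (U.card * d) ht
  rw [hE, card_crossEdges hU, hT] at hmain
  refine (measure_mono ?_).trans hmain
  rintro ω ⟨hω, hd⟩
  refine ⟨hω, ?_⟩
  calc _ ≤ ((∑ u ∈ U, deg (gnpGraph ω.1) u : ℕ) : ℝ) :=
        Nat.cast_le.2 (card_crossEdges_inter_le U S.1 ω.1)
    _ = ∑ u ∈ U, (deg (gnpGraph ω.1) u : ℝ) := by push_cast; rfl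
    _ ≤ U.card * d := by
        rw [← nsmul_eq_mul]; exact Finset.sum_le_card_nsmul _ _ _ hd

/-- Union bound over all trees joining `k` vertices of small degree. -/
lemma gnp2_bad_le {n k : ℕ} {p₀ p' : ℝ} (h0 : 0 ≤ p₀) (h1 : p₀ ≤ 1) (h0' : 0 ≤ p')
    (h1' : p' ≤ 1) (ℓ : ℕ) (t d : ℝ) (ht : 0 ≤ t) :
    gnp2 n p₀ p' {ω | ∃ v : Fin n, k ≤ (nbhd (gnpGraph ω.1 ⊔ gnpGraph ω.2) ℓ v ∩
        {u | (deg (gnpGraph ω.1) u : ℝ) ≤ d}).ncard} ≤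
      ENNReal.ofReal (∑ m ∈ Finset.range (ℓ * k + 1), (n ^ (m + 1) * m.factorial * 2 ^ (m + 1)) *
        (Real.exp (t * (k * d)) * ((1 - (1 - p₀) * (1 - p')) ^ m *
        (1 - p₀ * (1 - Real.exp (-t))) ^ (k * (n - (m + 1)))))) := by
  have hp₁ : 0 ≤ 1 - (1 - p₀) * (1 - p') := by nlinarith
  have hr : 0 ≤ 1 - p₀ * (1 - Real.exp (-t)) := by nlinarith [Real.exp_pos (-t)]
  rw [ENNReal.ofReal_sum_of_nonneg fun m _ => by positivity]
  have hsub : {ω : GnpSpace n × GnpSpace n | ∃ v : Fin n,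
      k ≤ (nbhd (gnpGraph ω.1 ⊔ gnpGraph ω.2) ℓ v ∩
        {u | (deg (gnpGraph ω.1) u : ℝ) ≤ d}).ncard} ⊆
      ⋃ m ∈ Finset.range (ℓ * k + 1), ⋃ S ∈ grownTrees n m, ⋃ U ∈ S.1.powersetCard k,
        {ω | (∀ e ∈ S.2, e ∈ (gnpGraph ω.1 ⊔ gnpGraph ω.2).edgeSet) ∧
          ∀ u ∈ U, (deg (gnpGraph ω.1) u : ℝ) ≤ d} := by
    rintro ω ⟨v, hv⟩
    obtain ⟨W, hW, hWk⟩ := Set.exists_subset_card_eq hv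
    obtain ⟨U, rfl⟩ := (Set.toFinite W).exists_finset_coe
    rw [Set.ncard_coe_finset] at hWk
    obtain ⟨m, hm, S, hS, -, hUS, hE⟩ := exists_grownTree _ v ℓ U fun u hu => (hW hu).1.2
    simp only [Set.mem_iUnion]
    exact ⟨m, by rw [Finset.mem_range, ← hWk]; omega, S, hS, U,
      Finset.mem_powersetCard.2 ⟨hUS, hWk⟩, hE, fun u hu => (hW hu).2⟩
  refine (measure_mono hsub).trans ((measure_biUnion_finset_le _ _).trans
    (Finset.sum_le_sum fun m _ => ?_))
  set B := Real.exp (t * (k * d)) * ((1 - (1 - p₀) * (1 - p')) ^ m *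
        (1 - p₀ * (1 - Real.exp (-t))) ^ (k * (n - (m + 1))))
  have hS : ∀ S ∈ grownTrees n m, gnp2 n p₀ p' (⋃ U ∈ S.1.powersetCard k,
        {ω | (∀ e ∈ S.2, e ∈ (gnpGraph ω.1 ⊔ gnpGraph ω.2).edgeSet) ∧
          ∀ u ∈ U, (deg (gnpGraph ω.1) u : ℝ) ≤ d}) ≤
        ((2 ^ (m + 1) : ℕ) : ℝ≥0∞) * ENNReal.ofReal B := by
    intro S hS
    refine (measure_biUnion_finset_le _ _).trans ?_
    refine (Finset.sum_le_card_nsmul _ _ (ENNReal.ofReal B) fun U hU => ?_).trans ?_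
    · obtain ⟨hUS, hUk⟩ := Finset.mem_powersetCard.1 hU
      have := gnp2_tree_le h0 h1 h0' h1' hS hUS t d ht
      rwa [hUk] at this
    · rw [nsmul_eq_mul]
      gcongr
      rw [Finset.card_powersetCard, (grownTrees_spec hS).1]
      exact Nat.choose_le_two_pow _ _
  refine (measure_biUnion_finset_le _ _).trans ((Finset.sum_le_card_nsmul _ _ _ hS).trans ?_)
  rw [nsmul_eq_mul, ENNReal.ofReal_mul (q := B) (by positivity), ← mul_assoc]
  refine mul_le_mul' ?_ le_rfl
  rw [show ((n : ℝ) ^ (m + 1) * m.factorial * 2 ^ (m + 1)) =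
    ((n ^ (m + 1) * m.factorial * 2 ^ (m + 1) : ℕ) : ℝ) by push_cast; rfl, ENNReal.ofReal_natCast]
  exact_mod_cast Nat.mul_le_mul_right _ (card_grownTrees n m)

/-! ### Asymptotics -/

lemma tree_bound_le {n m k : ℕ} {p₀ p₁ ε η t δ : ℝ} (hk : 0 < k) (hn : 0 < n) (hε : 0 < ε)
    (h0 : 0 ≤ p₀) (hp₁ : 0 ≤ p₁) (hp₁' : p₁ ≤ (1 + ε) * p₀)
    (hp : (1 + ε) * Real.log n / (k * n) ≤ p₀) (hp01 : p₀ ≤ 1)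
    (hη : 0 < η) (hηε : η = ε / (2 * (1 + ε))) (ht : Real.exp (-t) = η / 3)
    (hδ : t * δ = η / 3) (hnm : ((m : ℝ) + 1) ≤ η / 3 * n) :
    (n ^ (m + 1) * m.factorial * 2 ^ (m + 1)) *
        (Real.exp (t * (k * (δ * n * p₀))) * (p₁ ^ m *
        (1 - p₀ * (1 - Real.exp (-t))) ^ (k * (n - (m + 1))))) ≤
      (m.factorial * 2 ^ (m + 1) * (1 + ε) ^ m) *
        ((n * p₀) ^ m * Real.exp (-(k * η) * (n * p₀))) := by
  have hη1 : η ≤ 1 / 2 := by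
    rw [hηε, div_le_div_iff₀ (by positivity) (by norm_num)]; linarith
  have hnR : (0 : ℝ) < n := Nat.cast_pos.2 hn
  have hkR : (0 : ℝ) < k := Nat.cast_pos.2 hk
  have hmn : m + 1 ≤ n := by
    have : ((m + 1 : ℕ) : ℝ) ≤ n := by push_cast; nlinarith
    exact_mod_cast this
  have hbase : 0 ≤ 1 - p₀ * (1 - Real.exp (-t)) := by rw [ht]; nlinarith
  have hpow : (1 - p₀ * (1 - Real.exp (-t))) ^ (k * (n - (m + 1))) ≤
      Real.exp (-(k * (n * p₀)) * (1 - η / 3) ^ 2) := by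
    calc _ ≤ Real.exp (-(p₀ * (1 - Real.exp (-t)))) ^ (k * (n - (m + 1))) := by
          gcongr
          linarith [Real.add_one_le_exp (-(p₀ * (1 - Real.exp (-t))))]
      _ = Real.exp (-(k * (1 - η / 3) * p₀ * (n - (m + 1)))) := by
          rw [← Real.exp_nat_mul, ht]; push_cast [Nat.cast_sub hmn]; congr 1; ring
      _ ≤ _ := by
          apply Real.exp_le_exp.2
          have : (0 : ℝ) ≤ k * (1 - η / 3) * p₀ := by
            have : (0 : ℝ) ≤ 1 - η / 3 := by linarith
            positivity
          nlinarith [mul_le_mul_of_nonneg_left hnm this]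
  have hlog : (n : ℝ) * Real.exp (-(k * (n * p₀)) / (1 + ε)) ≤ 1 := by
    have h : Real.log n ≤ k * (n * p₀) / (1 + ε) := by
      rw [div_le_iff₀ (by positivity)] at hp
      rw [le_div_iff₀ (by positivity)]
      linarith
    calc (n : ℝ) * Real.exp (-(k * (n * p₀)) / (1 + ε))
        = Real.exp (Real.log n + -(k * (n * p₀)) / (1 + ε)) := by
          rw [Real.exp_add, Real.exp_log hnR]
      _ ≤ 1 := Real.exp_le_one_iff.2 (by rw [neg_div]; linarith)
  have hexp : Real.exp (t * (k * (δ * n * p₀))) * Real.exp (-(k * (n * p₀)) * (1 - η / 3) ^ 2) ≤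
      Real.exp (-(k * (n * p₀)) / (1 + ε)) * Real.exp (-(k * η) * (n * p₀)) := by
    rw [← Real.exp_add, ← Real.exp_add]
    apply Real.exp_le_exp.2
    have h1 : t * (k * (δ * n * p₀)) = k * (n * p₀) * (η / 3) := by rw [← hδ]; ring
    have h2 : 1 / (1 + ε) = 1 - 2 * η := by rw [hηε]; field_simp; ring
    rw [h1, div_eq_mul_one_div (-(k * (n * p₀))), h2]
    have h3 : (0 : ℝ) ≤ k * (n * p₀) := by positivity
    nlinarith [mul_nonneg h3 (sq_nonneg η)]
  calc _ ≤ (n ^ (m + 1) * m.factorial * 2 ^ (m + 1)) *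
        (Real.exp (t * (k * (δ * n * p₀))) * (((1 + ε) * p₀) ^ m *
          Real.exp (-(k * (n * p₀)) * (1 - η / 3) ^ 2))) := by gcongr
    _ = (m.factorial * 2 ^ (m + 1) * (1 + ε) ^ m) * ((n * p₀) ^ m * (n *
        (Real.exp (t * (k * (δ * n * p₀))) *
          Real.exp (-(k * (n * p₀)) * (1 - η / 3) ^ 2)))) := by
        rw [mul_pow, mul_pow]; ring
    _ ≤ (m.factorial * 2 ^ (m + 1) * (1 + ε) ^ m) * ((n * p₀) ^ m * (n *
        (Real.exp (-(k * (n * p₀)) / (1 + ε)) * Real.exp (-(k * η) * (n * p₀))))) := by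
        gcongr
    _ = (m.factorial * 2 ^ (m + 1) * (1 + ε) ^ m) * ((n * p₀) ^ m *
        ((n * Real.exp (-(k * (n * p₀)) / (1 + ε))) * Real.exp (-(k * η) * (n * p₀)))) := by
        ring
    _ ≤ (m.factorial * 2 ^ (m + 1) * (1 + ε) ^ m) * ((n * p₀) ^ m *
        (1 * Real.exp (-(k * η) * (n * p₀)))) := by gcongr
    _ = _ := by rw [one_mul]

lemma tendsto_pow_mul_exp_neg_mul (m : ℕ) {c : ℝ} (hc : 0 < c) :
    Tendsto (fun x : ℝ => x ^ m * Real.exp (-c * x)) atTop (nhds 0) := by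
  have h := (Real.tendsto_pow_mul_exp_neg_atTop_nhds_zero m).comp
    (tendsto_id.const_mul_atTop hc)
  have h' := h.const_mul (c ^ m)⁻¹
  rw [mul_zero] at h'
  refine h'.congr fun x => ?_
  simp only [Function.comp, id, mul_pow, neg_mul]
  field_simp

theorem statement_6 (k : ℕ) (hk : 2 ≤ k) (ε : ℝ) (hε : 0 < ε) :
    ∃ δ : ℝ, 0 < δ ∧ ∀ p₀ p' : ℕ → ℝ,
      (∀ n : ℕ, (1 + ε) * Real.log n / (k * n) ≤ p₀ n) → (∀ n : ℕ, p₀ n ≤ 1) →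
      (∀ n : ℕ, 0 ≤ p' n) → (∀ n : ℕ, p' n ≤ ε * p₀ n) → (∀ n : ℕ, p' n ≤ 1) →
      Tendsto (fun n : ℕ =>
        gnp2 n (p₀ n) (p' n) {ω : GnpSpace n × GnpSpace n |
          ∀ v : Fin n,
            (nbhd (gnpGraph ω.1 ⊔ gnpGraph ω.2) 3 v ∩
              (TINY (gnpGraph ω.1) (p₀ n) δ ∪
                TINY (gnpGraph ω.1 ⊔ gnpGraph ω.2) (1 - (1 - p₀ n) * (1 - p' n)) δ)).ncard
              ≤ k - 1})
        atTop (nhds 1) := by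
  set η : ℝ := ε / (2 * (1 + ε)) with hηdef
  have hη : 0 < η := by positivity
  have hη1 : η ≤ 1 / 2 := by
    rw [hηdef, div_le_div_iff₀ (by positivity) (by norm_num)]; linarith
  set t : ℝ := -Real.log (η / 3) with htdef
  have ht : 0 < t := by
    have := Real.log_neg (x := η / 3) (by positivity) (by linarith)
    rw [htdef]; linarith
  have hexp : Real.exp (-t) = η / 3 := by
    rw [htdef, neg_neg, Real.exp_log (by positivity)]
  set d : ℝ := η / 3 / t with hddef
  have hd : 0 < d := by positivity
  have htd : t * d = η / 3 := by rw [hddef]; field_simp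
  refine ⟨d / (1 + ε), by positivity, fun p₀ p' hp hp1 hq0 hq hq1 => ?_⟩
  have hp0 : ∀ n, 0 ≤ p₀ n := fun n => le_trans (by
    have := Real.log_natCast_nonneg n
    positivity) (hp n)
  have hprob : ∀ n, IsProbabilityMeasure (gnp2 n (p₀ n) (p' n)) := fun n =>
    isProbabilityMeasure_gnp2 n (hp0 n) (hp1 n) (hq0 n) (hq1 n)
  have hp₁ : ∀ n, 1 - (1 - p₀ n) * (1 - p' n) ≤ (1 + ε) * p₀ n := fun n => by
    nlinarith [mul_nonneg (hp0 n) (hq0 n), hq n]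
  have hp₁0 : ∀ n, 0 ≤ 1 - (1 - p₀ n) * (1 - p' n) := fun n => by
    nlinarith [hp0 n, hp1 n, hq0 n, hq1 n]
  have hdeg : Tendsto (fun n : ℕ => (n : ℝ) * p₀ n) atTop atTop := by
    have hlog : Tendsto (fun n : ℕ => (1 + ε) / k * Real.log n) atTop atTop :=
      (Real.tendsto_log_atTop.comp tendsto_natCast_atTop_atTop).const_mul_atTop
        (by have : (0 : ℝ) < k := Nat.cast_pos.2 (by omega)
            positivity)
    refine tendsto_atTop_mono' _ ?_ hlog
    filter_upwards [eventually_gt_atTop 0] with n hn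
    have hnR : (0 : ℝ) < n := Nat.cast_pos.2 hn
    have hkR : (0 : ℝ) < k := Nat.cast_pos.2 (by omega)
    calc (1 + ε) / k * Real.log n = n * ((1 + ε) * Real.log n / (k * n)) := by field_simp
      _ ≤ n * p₀ n := by gcongr; exact hp n
  set bound : ℕ → ℝ := fun n => ∑ m ∈ Finset.range (3 * k + 1),
    (m.factorial * 2 ^ (m + 1) * (1 + ε) ^ m) *
      ((n * p₀ n) ^ m * Real.exp (-(k * η) * (n * p₀ n))) with hbound
  have hbound0 : Tendsto bound atTop (nhds 0) := by
    refine Finset.sum_const_zero (M := ℝ) (s := Finset.range (3 * k + 1)) ▸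
      tendsto_finsetSum (Finset.range (3 * k + 1)) fun m _ => ?_
    have hc : (0 : ℝ) < k * η := mul_pos (Nat.cast_pos.2 (by omega)) hη
    simpa using ((tendsto_pow_mul_exp_neg_mul m hc).comp hdeg).const_mul
      ((m.factorial : ℝ) * 2 ^ (m + 1) * (1 + ε) ^ m)
  have hbad : ∀ᶠ n : ℕ in atTop, gnp2 n (p₀ n) (p' n) {ω : GnpSpace n × GnpSpace n |
          ∀ v : Fin n,
            (nbhd (gnpGraph ω.1 ⊔ gnpGraph ω.2) 3 v ∩
              (TINY (gnpGraph ω.1) (p₀ n) (d / (1 + ε)) ∪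
                TINY (gnpGraph ω.1 ⊔ gnpGraph ω.2) (1 - (1 - p₀ n) * (1 - p' n))
                  (d / (1 + ε)))).ncard ≤ k - 1}ᶜ ≤ ENNReal.ofReal (bound n) := by
    have hlarge : ∀ᶠ n : ℕ in atTop, (3 * (k : ℝ) + 1) / (η / 3) ≤ n :=
      tendsto_natCast_atTop_atTop.eventually_ge_atTop _
    filter_upwards [eventually_gt_atTop 0, hlarge] with n hn hn'
    rw [div_le_iff₀ (by positivity)] at hn'
    refine (measure_mono ?_).trans ((gnp2_bad_le (k := k) (hp0 n) (hp1 n) (hq0 n) (hq1 n) 3 t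
      (d * n * p₀ n) ht.le).trans (ENNReal.ofReal_le_ofReal (Finset.sum_le_sum fun m hm => ?_)))
    · intro ω hω
      simp only [Set.mem_compl_iff, Set.mem_ofPred_eq, not_forall, not_le] at hω
      obtain ⟨v, hv⟩ := hω
      refine ⟨v, (Nat.le_of_pred_lt hv).trans (Set.ncard_le_ncard ?_ (Set.toFinite _))⟩
      refine Set.inter_subset_inter_right _ ?_
      have hdn : 0 ≤ d / (1 + ε) * n := by positivity
      rintro u (hu | hu)
      · simp only [TINY, Set.mem_ofPred_eq, Nat.card_eq_fintype_card, Fintype.card_fin] at hu ⊢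
        refine hu.le.trans ?_
        have : d / (1 + ε) ≤ d := div_le_self hd.le (by linarith)
        have := hp0 n
        gcongr
      · simp only [TINY, Set.mem_ofPred_eq, Nat.card_eq_fintype_card, Fintype.card_fin] at hu ⊢
        calc (deg (gnpGraph ω.1) u : ℝ) ≤ deg (gnpGraph ω.1 ⊔ gnpGraph ω.2) u :=
              Nat.cast_le.2 (deg_mono le_sup_left u)
          _ ≤ d / (1 + ε) * n * (1 - (1 - p₀ n) * (1 - p' n)) := hu.le
          _ ≤ d / (1 + ε) * n * ((1 + ε) * p₀ n) := by gcongr; exact hp₁ n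
          _ = d * n * p₀ n := by field_simp
    · refine tree_bound_le (by omega) hn hε (hp0 n) (hp₁0 n) (hp₁ n) (hp n) (hp1 n) hη hηdef
        hexp htd ?_
      have : (m : ℝ) ≤ 3 * k := by
        exact_mod_cast Nat.lt_succ_iff.1 (Finset.mem_range.1 hm)
      linarith
  have hlim : Tendsto (fun n => ENNReal.ofReal (bound n)) atTop (nhds 0) := by
    simpa using ENNReal.tendsto_ofReal hbound0
  have hcompl := tendsto_of_tendsto_of_tendsto_of_le_of_le' tendsto_const_nhds hlim
    (Eventually.of_forall fun _ => zero_le) hbad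
  have hsub := ENNReal.Tendsto.sub (tendsto_const_nhds (x := (1 : ℝ≥0∞)) (f := atTop)) hcompl
    (Or.inl one_ne_top)
  rw [tsub_zero] at hsub
  refine hsub.congr fun n => ?_
  rw [← prob_compl_eq_one_sub (Set.toFinite _).measurableSet, compl_compl]

end
end RGP
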